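/- Let n > 2m with m ≥ 1, let L be a uniformly elliptic constant-coefficient operator of order 2m on ℝⁿ with ellipticity constant λ > 0, and let K : ℝⁿ → ℝ be locally integrable, continuous on ℝⁿ\{0}, homogeneous of degree 2m−n, and a fundamental solution of L. Then there exists y ∈ ℝⁿ\{0} such that K(y) > 0. -/

import Mathlib

open MeasureTheory RealInnerProductSpace

noncomputable section

/-- ℝⁿ as a Euclidean space. -/
abbrev En (n : ℕ) : Type := EuclideanSpace ℝ (Fin n)

/-- The `i`-th standard basis vector of ℝⁿ. -/
def stdB (n : ℕ) (i : Fin n) : En n := EuclideanSpace.single i 1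

/-- The symbol Q(ξ) = Σ_{i₁,…,i_{2m}} A_{i₁…i_{2m}} ξ_{i₁}⋯ξ_{i_{2m}}. -/
def symbolQ (n m : ℕ) (A : (Fin (2*m) → Fin n) → ℝ) (ξ : En n) : ℝ :=
  ∑ i : Fin (2*m) → Fin n, A i * ∏ j, ξ (i j)

/-- The constant-coefficient operator
(Lψ)(x) = (−1)^m Σ A_{i₁…i_{2m}} ∂_{i₁}⋯∂_{i_{2m}} ψ(x). -/
def opL (n m : ℕ) (A : (Fin (2*m) → Fin n) → ℝ) (ψ : En n → ℝ) (x : En n) : ℝ :=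
  (-1 : ℝ)^m * ∑ i : Fin (2*m) → Fin n,
    A i * iteratedFDeriv ℝ (2*m) ψ x (fun j => stdB n (i j))

/-- K is a fundamental solution of L: ∫ K(y) (Lψ)(y) dy = ψ(0) for all ψ ∈ C_c^∞. -/
def IsFundamentalSolution (n m : ℕ) (A : (Fin (2*m) → Fin n) → ℝ) (K : En n → ℝ) : Prop :=
  ∀ ψ : En n → ℝ, ContDiff ℝ (⊤ : ℕ∞) ψ → HasCompactSupport ψ →
    ∫ y, K y * opL n m A ψ y = ψ 0

/-- K is homogeneous of degree a: K(σx) = |σ|^a K(x) for σ ≠ 0, x ≠ 0. -/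
def HomogeneousDeg (n : ℕ) (a : ℝ) (K : En n → ℝ) : Prop :=
  ∀ σ : ℝ, σ ≠ 0 → ∀ x : En n, x ≠ 0 → K (σ • x) = |σ| ^ a * K x

/-- The Euclidean Laplacian Δf(x) = Σ_i ∂²f/∂x_i²(x). -/
def lap (n : ℕ) (f : En n → ℝ) (x : En n) : ℝ :=
  ∑ i : Fin n, iteratedFDeriv ℝ 2 f x (fun _ => stdB n i)

/-- The point (x′, t) ∈ ℝ^{d} × ℝ = ℝ^{d+1}. -/
def snocVec (d : ℕ) (x' : En d) (t : ℝ) : En (d+1) :=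
  (EuclideanSpace.equiv (Fin (d+1)) ℝ).symm (Fin.snoc (fun i => x' i) t)


lemma nat_le_inf (k : ℕ) : ((k : ℕ) : WithTop ℕ∞) ≤ ((⊤ : ℕ∞) : WithTop ℕ∞) := by
  exact_mod_cast le_top

open Set in
lemma polar_aux (n : ℕ) (hn : 0 < n) (a : ℝ) (K : En n → ℝ) (hK : HomogeneousDeg n a K) (F : ℝ → ℝ) :
    ∫ x, K x * F ‖x‖ = (∫ w : Metric.sphere (0 : En n) 1, K w ∂(volume : Measure (En n)).toSphere) *
      ∫ r : Ioi (0:ℝ), (r:ℝ)^a * F r ∂(Measure.volumeIoiPow (n-1)) := by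
  have : Nonempty (Fin n) := ⟨⟨0, hn⟩⟩
  have hd : Module.finrank ℝ (En n) = n := by simp
  have mp := (volume : Measure (En n)).measurePreserving_homeomorphUnitSphereProd
  rw [hd] at mp
  rw [← integral_prod_mul (fun w : Metric.sphere (0 : En n) 1 => K w) 
    (fun r : Ioi (0:ℝ) => (r:ℝ)^a * F r)]
  rw [← mp.integral_comp (Homeomorph.measurableEmbedding _)]
  have e : ∫ x, K x * F ‖x‖ = ∫ x : ({(0 : En n)}ᶜ : Set (En n)), K x * F ‖(x : En n)‖
      ∂((volume : Measure (En n)).comap (↑)) := by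
    rw [integral_subtype_comap (measurableSet_singleton _).compl fun x ↦ K x * F ‖x‖,
        restrict_compl_singleton]
  rw [e]
  refine integral_congr_ae (.of_forall ?_)
  rintro ⟨x, hx⟩
  have hx0 : x ≠ 0 := hx
  have hp : 0 < ‖x‖ := norm_pos_iff.2 hx0
  simp only [homeomorphUnitSphereProd_apply_fst_coe, homeomorphUnitSphereProd_apply_snd_coe]
  have := hK ‖x‖ hp.ne' (‖x‖⁻¹ • x) (by simp [hx0])
  rw [smul_inv_smul₀ hp.ne', abs_norm] at this
  rw [this]; ring

lemma opL_bound (n m : ℕ) (A : (Fin (2*m) → Fin n) → ℝ) (φ : En n → ℝ) (x : En n) :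
    |opL n m A φ x| ≤ (∑ i, |A i|) * ‖iteratedFDeriv ℝ (2*m) φ x‖ := by
  unfold opL
  rw [abs_mul, abs_pow, abs_neg, abs_one, one_pow, one_mul, Finset.sum_mul]
  refine (Finset.abs_sum_le_sum_abs _ _).trans (Finset.sum_le_sum fun i _ => ?_)
  rw [abs_mul]
  have h := ContinuousMultilinearMap.le_opNorm (iteratedFDeriv ℝ (2*m) φ x) (fun j => stdB n (i j))
  have h2 : ∏ j, ‖stdB n (i j)‖ = 1 := by simp [stdB]
  rw [h2, mul_one, Real.norm_eq_abs] at h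
  gcongr

lemma opL_cont (n m : ℕ) (A : (Fin (2*m) → Fin n) → ℝ) (φ : En n → ℝ) (h : ContDiff ℝ (⊤ : ℕ∞) φ) :
    Continuous (opL n m A φ) := by
  unfold opL
  have : Continuous (iteratedFDeriv ℝ (2*m) φ) := h.continuous_iteratedFDeriv (nat_le_inf _)
  refine continuous_const.mul (continuous_finsetSum _ fun i _ => continuous_const.mul ?_)
  exact (ContinuousMultilinearMap.apply ℝ (fun _ : Fin (2*m) => En n) ℝ (fun j => stdB n (i j))).continuous.comp this

lemma K_int (n : ℕ) (hn : 0 < n) (a : ℝ) (ha : a ≤ 0) (K : En n → ℝ)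
    (hKloc : LocallyIntegrable K volume)
    (hKcont : ContinuousOn K {(0 : En n)}ᶜ)
    (hKhom : HomogeneousDeg n a K) :
    Integrable (fun x => K x * (1 + ‖x‖) ^ (-((n:ℝ)+1))) volume := by
  have : Nonempty (Fin n) := ⟨⟨0, hn⟩⟩
  have hmeas : AEStronglyMeasurable (fun x : En n => K x * (1 + ‖x‖) ^ (-((n:ℝ)+1))) volume := by
    refine hKloc.aestronglyMeasurable.mul (Continuous.aestronglyMeasurable ?_)
    refine Continuous.rpow_const (by fun_prop) fun x => Or.inl (by positivity)
  have hint : Integrable (fun x : En n => (1 + ‖x‖) ^ (-((n:ℝ)+1))) volume :=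
    integrable_one_add_norm (by simp)
  obtain ⟨C, hC⟩ := (isCompact_sphere (0 : En n) 1).exists_bound_of_continuousOn 
    (hKcont.mono (fun x hx => by
      rintro rfl
      simp at hx))
  have hC0 : 0 ≤ C := by
    obtain ⟨w, hw⟩ := NormedSpace.sphere_nonempty (E := En n) (x := 0) (r := 1) |>.2 zero_le_one
    exact (norm_nonneg _).trans (hC w hw)
  have h1 : IntegrableOn K (Metric.closedBall 0 1) volume :=
    hKloc.integrableOn_isCompact (isCompact_closedBall _ _)
  have h1' := 
    (integrable_indicator_iff (Metric.isClosed_closedBall.measurableSet)).2 h1.norm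
  refine (h1'.add (hint.const_mul C)).mono' hmeas (.of_forall fun x => ?_)
  have hle : (1 + ‖x‖) ^ (-((n:ℝ)+1)) ≤ 1 := 
    Real.rpow_le_one_of_one_le_of_nonpos (by simp) (by linarith [(Nat.cast_nonneg n : (0:ℝ) ≤ n)])
  have hnn : 0 ≤ (1 + ‖x‖) ^ (-((n:ℝ)+1)) := by positivity
  rw [norm_mul, Real.norm_of_nonneg hnn]
  simp only [Pi.add_apply]
  by_cases hx : x ∈ Metric.closedBall (0 : En n) 1
  · rw [Set.indicator_of_mem hx]
    have := mul_le_mul_of_nonneg_left hle (norm_nonneg (K x))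
    have := mul_nonneg hC0 hnn
    linarith
  · rw [Set.indicator_of_notMem hx, zero_add]
    gcongr
    have hx1 : 1 < ‖x‖ := by simpa using hx
    have hp : 0 < ‖x‖ := by linarith
    have := hKhom ‖x‖ hp.ne' (‖x‖⁻¹ • x) (by simpa using norm_pos_iff.1 hp)
    rw [smul_inv_smul₀ hp.ne', abs_norm] at this
    rw [this, norm_mul, Real.norm_of_nonneg (by positivity)]
    have h2 := hC (‖x‖⁻¹ • x) (by simp [norm_smul, hp.ne'])
    have h3 := Real.rpow_le_one_of_one_le_of_nonpos hx1.le ha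
    calc _ ≤ 1 * ‖K (‖x‖⁻¹ • x)‖ := by gcongr
      _ ≤ C := by simpa using h2

open Filter Topology in
lemma extend_schwartz (n m : ℕ) (hn : 0 < n) (A : (Fin (2*m) → Fin n) → ℝ) (K : En n → ℝ)
    (hKloc : LocallyIntegrable K volume)
    (hKint : Integrable (fun x => K x * (1 + ‖x‖) ^ (-((n:ℝ)+1))) volume)
    (hKfund : IsFundamentalSolution n m A K) (ψ : SchwartzMap (En n) ℝ) :
    ∫ y, K y * opL n m A ψ y = ψ 0 := by
  let χ : ContDiffBump (0 : En n) := ⟨1, 2, one_pos, one_lt_two⟩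
  have hχs : ContDiff ℝ (⊤ : ℕ∞) χ := χ.contDiff
  let χS : SchwartzMap (En n) ℝ := χ.hasCompactSupport.toSchwartzMap hχs
  have hχS : (χS : En n → ℝ) = χ := rfl
  let a : ℕ → ℝ := fun N => ((N:ℝ)+1)⁻¹
  have ha0 : ∀ N, 0 < a N := fun N => by simp only [a]; positivity
  have ha1 : ∀ N, a N ≤ 1 := fun N => by
    simp only [a]; exact inv_le_one_of_one_le₀ (by linarith [(Nat.cast_nonneg N : (0:ℝ) ≤ N)])
  have hat : Tendsto a atTop (𝓝 0) := by
    simpa [a] using tendsto_one_div_add_atTop_nhds_zero_nat (𝕜 := ℝ)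
  let φ : ℕ → En n → ℝ := fun N x => χ (a N • x)
  have hφs : ∀ N, ContDiff ℝ (⊤ : ℕ∞) (φ N) := fun N => hχs.comp (contDiff_const_smul _)
  have hψs : ContDiff ℝ (⊤ : ℕ∞) ψ := ψ.smooth ⊤
  let Ψ : ℕ → En n → ℝ := fun N x => φ N x * ψ x
  have hΨs : ∀ N, ContDiff ℝ (⊤ : ℕ∞) (Ψ N) := fun N => (hφs N).mul hψs
  have hΨc : ∀ N, HasCompactSupport (Ψ N) := fun N => by
    have : HasCompactSupport (φ N) := χ.hasCompactSupport.comp_homeomorph (Homeomorph.smulOfNeZero (a N) (ha0 N).ne')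
    exact this.mul_right
  have hΨ0 : ∀ N, ∫ y, K y * opL n m A (Ψ N) y = ψ 0 := fun N => by
    rw [hKfund _ (hΨs N) (hΨc N)]
    have : χ (0 : En n) = 1 := χ.one_of_mem_closedBall (by simp [χ])
    simp [Ψ, φ, this]
  choose Cχ hCχ0 hCχ using fun i => χS.decay 0 i
  have hψd : ∀ i, ∃ C, 0 ≤ C ∧ ∀ x, ‖iteratedFDeriv ℝ i ψ x‖ ≤ C * (1 + ‖x‖) ^ (-((n:ℝ)+1)) := by
    intro i
    refine ⟨2 ^ (n+1) * ((Finset.Iic (n+1, i)).sup fun m => SchwartzMap.seminorm ℝ m.1 m.2) ψ,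
      by positivity, fun x => ?_⟩
    · have := SchwartzMap.one_add_le_sup_seminorm_apply (𝕜 := ℝ) (m := (n+1, i)) (k := n+1) (n := i) le_rfl le_rfl ψ x
      have hp : 0 < 1 + ‖x‖ := by positivity
      rw [Real.rpow_neg hp.le, ← div_eq_mul_inv, le_div_iff₀ (by positivity), mul_comm]
      have e : (1 + ‖x‖) ^ ((n:ℝ)+1) = (1 + ‖x‖) ^ (n+1) := by exact_mod_cast Real.rpow_natCast _ (n+1)
      rw [e]; exact this
  choose Cψ hCψ0 hCψ using hψd
  let S : ℝ := ∑ i, |A i|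
  have hS : 0 ≤ S := Finset.sum_nonneg fun i _ => abs_nonneg _
  let D : ℝ := ∑ i ∈ Finset.range (2*m+1), ((2*m).choose i : ℝ) * Cχ i * Cψ (2*m-i)
  have hlim : Tendsto (fun N => ∫ y, K y * opL n m A (Ψ N) y) atTop (𝓝 (∫ y, K y * opL n m A ψ y)) := by
    refine tendsto_integral_of_dominated_convergence 
      (fun x => (S * D) * ‖K x * (1 + ‖x‖) ^ (-((n:ℝ)+1))‖) (fun N => ?_) (hKint.norm.const_mul _) 
      (fun N => .of_forall fun x => ?_) (.of_forall fun x => ?_)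
    · exact hKloc.aestronglyMeasurable.mul (opL_cont n m A _ (hΨs N)).aestronglyMeasurable
    · have hnn : 0 ≤ (1 + ‖x‖) ^ (-((n:ℝ)+1)) := by positivity
      rw [norm_mul, norm_mul, Real.norm_of_nonneg hnn, Real.norm_eq_abs (opL _ _ _ _ _)]
      have h1 := opL_bound n m A (Ψ N) x
      have h2 : ‖iteratedFDeriv ℝ (2*m) (Ψ N) x‖ ≤ D * (1 + ‖x‖) ^ (-((n:ℝ)+1)) := by
        refine (norm_iteratedFDeriv_mul_le (hφs N) hψs x (n := 2*m) (nat_le_inf _)).trans ?_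
        rw [Finset.sum_mul]
        refine Finset.sum_le_sum fun i _ => ?_
        have h3 : ‖iteratedFDeriv ℝ i (φ N) x‖ ≤ Cχ i := by
          rw [iteratedFDeriv_comp_const_smul (a N) (hχs.of_le (nat_le_inf _))]
          rw [norm_smul, norm_pow, Real.norm_of_nonneg (ha0 N).le]
          have := hCχ i (a N • x)
          rw [pow_zero, one_mul, hχS] at this
          calc _ ≤ 1 * ‖iteratedFDeriv ℝ i χ (a N • x)‖ := by
                gcongr
                exact pow_le_one₀ (ha0 N).le (ha1 N)
            _ ≤ _ := by simpa using this
        rw [mul_assoc (_ * _)]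
        have := hCχ0 i
        gcongr
        exact hCψ _ _
      calc _ ≤ ‖K x‖ * (S * (D * (1 + ‖x‖) ^ (-((n:ℝ)+1)))) := by
            gcongr
            exact h1.trans (by gcongr)
        _ = _ := by ring
    · refine tendsto_const_nhds.congr' ?_
      have hev : ∀ᶠ N in atTop, a N * ‖x‖ < 1 := by
        have : Tendsto (fun N => a N * ‖x‖) atTop (𝓝 (0 * ‖x‖)) := hat.mul_const _
        rw [zero_mul] at this
        exact this.eventually_lt_const one_pos
      filter_upwards [hev] with N hN
      have : Ψ N =ᶠ[𝓝 x] ψ := by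
        have ho : IsOpen {y : En n | a N * ‖y‖ < 1} := isOpen_lt (by fun_prop) (by fun_prop)
        filter_upwards [ho.mem_nhds hN] with y hy
        have : χ (a N • y) = 1 := χ.one_of_mem_closedBall (by 
          simp only [mem_closedBall_zero_iff, norm_smul, Real.norm_of_nonneg (ha0 N).le]
          exact le_of_lt hy)
        simp [Ψ, φ, this]
      unfold opL
      rw [(this.iteratedFDeriv ℝ (2*m)).self_of_nhds]
  simp only [hΨ0] at hlim
  exact tendsto_nhds_unique hlim tendsto_const_nhds |>.symm ▸ rfl

def rho (n : ℕ) (ξ : En n) : ℝ := expNegInvGlue (‖ξ‖^2-1) * expNegInvGlue (4-‖ξ‖^2)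

lemma rho_smooth (n : ℕ) : ContDiff ℝ (⊤ : ℕ∞) (rho n) := by
  unfold rho
  have h : ContDiff ℝ (⊤ : ℕ∞) (fun ξ : En n => ‖ξ‖^2) := contDiff_norm_sq ℝ
  exact (expNegInvGlue.contDiff.comp (h.sub contDiff_const)).mul
    (expNegInvGlue.contDiff.comp (contDiff_const.sub h))

lemma rho_nonneg (n : ℕ) (ξ : En n) : 0 ≤ rho n ξ :=
  mul_nonneg (expNegInvGlue.nonneg _) (expNegInvGlue.nonneg _)

lemma rho_zero (n : ℕ) (ξ : En n) (h : ‖ξ‖ < 1) : rho n ξ = 0 := by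
  unfold rho
  rw [expNegInvGlue.zero_of_nonpos, zero_mul]
  nlinarith [norm_nonneg ξ]

lemma rho_cpt (n : ℕ) : HasCompactSupport (rho n) := by
  refine HasCompactSupport.intro (isCompact_closedBall (0 : En n) 2) fun x hx => ?_
  have : 2 < ‖x‖ := by simpa using hx
  unfold rho
  rw [expNegInvGlue.zero_of_nonpos (x := 4 - _), mul_zero]
  nlinarith

lemma rho_exists_pos (n : ℕ) (hn : 0 < n) : ∃ ξ : En n, 0 < rho n ξ ∧ ξ ≠ 0 := by
  refine ⟨EuclideanSpace.single ⟨0, hn⟩ (3/2), ?_, ?_⟩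
  · unfold rho
    apply mul_pos <;> apply expNegInvGlue.pos_of_pos <;> norm_num
  · simp

lemma symbolQ_smooth (n m : ℕ) (A : (Fin (2*m) → Fin n) → ℝ) : ContDiff ℝ (⊤ : ℕ∞) (symbolQ n m A) := by
  unfold symbolQ
  refine ContDiff.sum fun i _ => contDiff_const.mul (contDiff_prod fun j _ => ?_)
  fun_prop

lemma g_smooth (n m : ℕ) (A : (Fin (2*m) → Fin n) → ℝ) (hQ : ∀ ξ : En n, ξ ≠ 0 → 0 < symbolQ n m A ξ) :
    ContDiff ℝ (⊤ : ℕ∞) (fun ξ => rho n ξ / symbolQ n m A ξ) := by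
  rw [contDiff_iff_contDiffAt]
  intro ξ
  by_cases h : ξ = 0
  · subst h
    refine (contDiffAt_const (c := (0:ℝ))).congr_of_eventuallyEq ?_
    filter_upwards [Metric.ball_mem_nhds (0 : En n) one_pos] with x hx
    rw [rho_zero n x (by simpa using hx), zero_div]
  · exact (rho_smooth n).contDiffAt.div (symbolQ_smooth n m A).contDiffAt (hQ ξ h).ne'

open FourierTransform in
lemma opL_fourier (n m : ℕ) (A : (Fin (2*m) → Fin n) → ℝ) (g : En n → ℝ)
    (hg : Continuous g) (hc : HasCompactSupport g) (x : En n) :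
    opL n m A (fun x => (𝓕 (fun ξ => (g ξ : ℂ)) x).re) x =
      (2 * Real.pi)^(2*m) * (𝓕 (fun ξ => ((symbolQ n m A ξ * g ξ : ℝ) : ℂ)) x).re := by
  have hgC : Continuous (fun ξ => (g ξ : ℂ)) := by fun_prop
  have hcC : HasCompactSupport (fun ξ => (g ξ : ℂ)) := hc.comp_left (g := fun t : ℝ => (t : ℂ)) (by simp)
  have hint : ∀ k : ℕ, k ≤ (⊤ : ℕ∞) → Integrable (fun v : En n => ‖v‖ ^ k * ‖(g v : ℂ)‖) volume := fun k _ =>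
    Continuous.integrable_of_hasCompactSupport (by fun_prop) hcC.norm.mul_left
  have hF := Real.iteratedFDeriv_fourier hint hgC.aestronglyMeasurable (n := 2*m) le_top
  have hFs := Real.contDiff_fourier hint
  have hpt : ∀ v : Fin (2*m) → En n, 
      iteratedFDeriv ℝ (2*m) (fun x => (𝓕 (fun ξ => (g ξ : ℂ)) x).re) x v =
      ((-1)^m * (2*Real.pi)^(2*m) * 𝓕 (fun ξ : En n => ((∏ j, inner ℝ ξ (v j) : ℝ) : ℂ) * (g ξ : ℂ)) x).re := by
    intro v
    have := Complex.reCLM.iteratedFDeriv_comp_left (hFs.contDiffAt (x := x)) (nat_le_inf (2*m))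
    have e : (fun x => (𝓕 (fun ξ => (g ξ : ℂ)) x).re) = Complex.reCLM ∘ (𝓕 (fun ξ => (g ξ : ℂ))) := rfl
    rw [e, this, hF]
    simp only [ContinuousLinearMap.compContinuousMultilinearMap_coe, Function.comp_apply, Complex.reCLM_apply]
    congr 1
    rw [Real.fourier_continuousMultilinearMap_apply]
    swap
    · refine VectorFourier.integrable_fourierPowSMulRight _ (hint _ le_top) hgC.aestronglyMeasurable
    rw [Real.fourier_eq, Real.fourier_eq, ← integral_const_mul]
    congr 1
    ext ξ
    simp only [VectorFourier.fourierPowSMulRight_apply, Circle.smul_def, smul_eq_mul, Complex.real_smul]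
    have : (-(2 * Real.pi * Complex.I) : ℂ)^(2*m) = (-1)^m * (2*Real.pi)^(2*m) := by
      rw [neg_pow, pow_mul (-1 : ℂ) 2 m, mul_pow, pow_mul Complex.I]
      simp; ring
    rw [this]
    change _ * (_ * (((∏ i, inner ℝ ξ (v i) : ℝ) : ℂ) * _)) = _
    ring
  unfold opL
  simp only [hpt]
  have hsum : 𝓕 (fun ξ => ((symbolQ n m A ξ * g ξ : ℝ) : ℂ)) x = 
      ∑ i, (A i : ℂ) * 𝓕 (fun ξ : En n => ((∏ j, inner ℝ ξ (stdB n (i j)) : ℝ) : ℂ) * (g ξ : ℂ)) x := by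
    simp only [Real.fourier_eq, ← integral_const_mul]
    rw [← integral_finsetSum]
    · congr 1; ext ξ
      simp only [symbolQ, stdB, Circle.smul_def, smul_eq_mul, EuclideanSpace.inner_single_right]
      push_cast
      rw [Finset.sum_mul, Finset.mul_sum]
      refine Finset.sum_congr rfl fun i _ => ?_
      simp; ring
    · intro i _
      refine Integrable.const_mul ?_ _
      refine Continuous.integrable_of_hasCompactSupport ?_ ?_
      · simp only [Circle.smul_def]
        fun_prop
      · exact HasCompactSupport.smul_left (hcC.mul_left)
  rw [hsum, Complex.re_sum, Finset.mul_sum, Finset.mul_sum]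
  refine Finset.sum_congr rfl fun i _ => ?_
  rw [Complex.re_ofReal_mul]
  have : ((-1)^m * (2*Real.pi)^(2*m) : ℂ) = (((-1)^m * (2*Real.pi)^(2*m) : ℝ) : ℂ) := by push_cast; ring
  rw [this, Complex.re_ofReal_mul]
  have h1 : ((-1:ℝ)^m) * (-1)^m = 1 := by rw [← mul_pow]; simp
  linear_combination (A i * (2*Real.pi)^(2*m) * (𝓕 (fun ξ : En n => ((∏ j, inner ℝ ξ (stdB n (i j)) : ℝ) : ℂ) * (g ξ : ℂ)) x).re) * h1

lemma norm_rpow_hom (n : ℕ) (a : ℝ) : HomogeneousDeg n a (fun x : En n => ‖x‖ ^ a) := by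
  intro σ hσ x hx
  simp only [norm_smul, Real.norm_eq_abs]
  exact Real.mul_rpow (abs_nonneg _) (norm_nonneg _)

lemma norm_rpow_cont (n : ℕ) (a : ℝ) : ContinuousOn (fun x : En n => ‖x‖ ^ a) {(0 : En n)}ᶜ :=
  ContinuousOn.rpow_const (by fun_prop) fun x hx => Or.inl (norm_ne_zero_iff.2 hx)

lemma norm_rpow_loc (n : ℕ) (hn : 0 < n) (a : ℝ) (ha : -(n:ℝ) < a) :
    LocallyIntegrable (fun x : En n => ‖x‖ ^ a) volume := by
  have : Nonempty (Fin n) := ⟨⟨0, hn⟩⟩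
  rw [locallyIntegrable_iff]
  intro k hk
  obtain ⟨r, hr, hkr⟩ := hk.isBounded.subset_ball_lt 0 (0 : En n)
  refine IntegrableOn.mono_set ?_ hkr
  rw [integrableOn_fun_norm_addHaar volume (f := fun y => y ^ a)]
  have h1 := (intervalIntegral.integrableOn_Ioo_rpow_iff (s := (n:ℝ) - 1 + a) hr).2 (by linarith)
  refine h1.congr_fun (fun y hy => ?_) measurableSet_Ioo
  have hy0 : 0 < y := hy.1
  simp only [smul_eq_mul, finrank_euclideanSpace_fin]
  rw [Real.rpow_add hy0, ← Real.rpow_natCast, Nat.cast_sub hn, Nat.cast_one]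

open Set in
lemma riesz_pos (n : ℕ) (hn : 0 < n) (s : ℝ) (hs : 0 < s) (f : En n → ℝ) (hf : Continuous f)
    (hint : Integrable (fun x : En n => ‖x‖ ^ (-(2*s)) * f x) volume)
    (hpos : ∀ t : ℝ, 0 < t → 0 < ∫ x, f x * Real.exp (-(t * ‖x‖^2))) :
    0 < ∫ x, ‖x‖ ^ (-(2*s)) * f x := by
  have : Nonempty (Fin n) := ⟨⟨0, hn⟩⟩
  have hG : 0 < Real.Gamma s := Real.Gamma_pos_of_pos hs
  have hne : ∀ᵐ x : En n, x ≠ 0 := by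
    simp [ae_iff]
  have hgam : ∀ x : En n, x ≠ 0 → 
      ∫ t : ℝ in Ioi 0, t ^ (s - 1) * Real.exp (-(t * ‖x‖^2)) = ‖x‖ ^ (-(2*s)) * Real.Gamma s := by
    intro x hx
    have hp : 0 < ‖x‖ := norm_pos_iff.2 hx
    have h := Real.integral_rpow_mul_exp_neg_mul_Ioi hs (r := ‖x‖^2) (by positivity)
    simp only [mul_comm (‖x‖^2)] at h
    rw [h, one_div, Real.inv_rpow (by positivity), ← Real.rpow_natCast, ← Real.rpow_mul hp.le,
      ← Real.rpow_neg hp.le]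
    norm_num
  have hgamint : ∀ x : En n, x ≠ 0 → 
      IntegrableOn (fun t : ℝ => t ^ (s - 1) * Real.exp (-(t * ‖x‖^2))) (Ioi 0) := by
    intro x hx
    by_contra h
    have h1 := hgam x hx
    rw [integral_undef h] at h1
    have hp : 0 < ‖x‖ := norm_pos_iff.2 hx
    have : 0 < ‖x‖ ^ (-(2*s)) * Real.Gamma s := by positivity
    linarith
  let H : En n → ℝ → ℝ := fun x t => f x * (t ^ (s - 1) * Real.exp (-(t * ‖x‖^2)))
  have hHint : Integrable (Function.uncurry H) ((volume : Measure (En n)).prod (volume.restrict (Ioi 0))) := by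
    have hm : Measurable (Function.uncurry H) := by
      have := hf.measurable
      simp only [H, Function.uncurry_def]
      fun_prop
    rw [integrable_prod_iff hm.aestronglyMeasurable]
    constructor
    · filter_upwards [hne] with x hx
      exact (hgamint x hx).const_mul (f x)
    · have := hint.norm.mul_const (Real.Gamma s)
      refine this.congr ?_
      filter_upwards [hne] with x hx
      simp only [Function.uncurry_apply_pair, H, norm_mul]
      rw [integral_const_mul]
      have e : ∫ t : ℝ in Ioi 0, ‖t ^ (s - 1)‖ * ‖Real.exp (-(t * ‖x‖^2))‖ = 
          ∫ t : ℝ in Ioi 0, t ^ (s - 1) * Real.exp (-(t * ‖x‖^2)) := by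
        refine setIntegral_congr_fun measurableSet_Ioi fun t ht => ?_
        have ht0 : (0:ℝ) < t := ht
        rw [Real.norm_of_nonneg (by positivity), Real.norm_of_nonneg (by positivity)]
      rw [e, hgam x hx, Real.norm_of_nonneg (by positivity : 0 ≤ ‖x‖ ^ (-(2*s)))]
      ring
  have h1 : (∫ x, ‖x‖ ^ (-(2*s)) * f x) * Real.Gamma s = ∫ x, ∫ t in Ioi 0, H x t := by
    rw [← integral_mul_const]
    refine integral_congr_ae ?_
    filter_upwards [hne] with x hx
    simp only [H]
    rw [integral_const_mul, hgam x hx]; ring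
  rw [integral_integral_swap hHint] at h1
  have h2 : ∀ t, ∫ x, H x t = t ^ (s-1) * ∫ x, f x * Real.exp (-(t * ‖x‖^2)) := by
    intro t
    rw [← integral_const_mul]
    congr 1; ext x; simp only [H]; ring
  have hposH : ∀ t, 0 < t → 0 < ∫ x, H x t := fun t ht => by
    rw [h2]; exact mul_pos (by positivity) (hpos t ht)
  have h3 : 0 < ∫ t in Ioi (0:ℝ), ∫ x, H x t := by
    rw [setIntegral_pos_iff_support_of_nonneg_ae]
    · have : Ioi (0:ℝ) ⊆ Function.support (fun t => ∫ x, H x t) ∩ Ioi 0 := fun t ht =>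
        ⟨(hposH t ht).ne', ht⟩
      exact lt_of_lt_of_le (by simp) (measure_mono this)
    · filter_upwards [ae_restrict_mem measurableSet_Ioi] with t ht
      exact (hposH t ht).le
    · exact hHint.integral_prod_right
  rw [← h1] at h3
  exact pos_of_mul_pos_left h3 hG.le

open FourierTransform in
lemma fourier_gauss_pos (n : ℕ) (r : En n → ℝ) (hr : Continuous r) (hc : HasCompactSupport r)
    (h0 : ∀ ξ, 0 ≤ r ξ) (hp : ∃ ξ, 0 < r ξ) 
    (hi : Integrable (𝓕 (fun ξ => (r ξ : ℂ))) volume) (t : ℝ) (ht : 0 < t) :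
    0 < ∫ x, (𝓕 (fun ξ => (r ξ : ℂ)) x).re * Real.exp (-(t * ‖x‖^2)) := by
  have hcC : HasCompactSupport (fun ξ => (r ξ : ℂ)) := hc.comp_left (g := fun t : ℝ => (t : ℂ)) (by simp)
  have hrint : Integrable (fun ξ => (r ξ : ℂ)) volume :=
    Continuous.integrable_of_hasCompactSupport (by fun_prop) hcC
  have htc : 0 < ((t:ℂ)).re := by simpa
  have hgint : Integrable (fun v : En n => Complex.exp (-(t:ℂ) * ‖v‖^2)) volume := by
    simpa using GaussianFourier.integrable_cexp_neg_mul_sq_norm_add (V := En n) htc 0 0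
  have key : ∫ x, 𝓕 (fun ξ => (r ξ : ℂ)) x • Complex.exp (-(t:ℂ) * ‖x‖^2) = 
      ∫ x, (r x : ℂ) • 𝓕 (fun v : En n => Complex.exp (-(t:ℂ) * ‖v‖^2)) x := by
    simpa using! (VectorFourier.integral_fourierIntegral_smul_eq_flip (L := innerₗ (En n))
      Real.continuous_fourierChar continuous_inner hrint hgint)
  have hexp : ∀ x : En n, Complex.exp (-(t:ℂ) * ‖x‖^2) = ((Real.exp (-(t * ‖x‖^2)) : ℝ) : ℂ) := by
    intro x; push_cast; congr 1; ring
  have hint1 : Integrable (fun x => 𝓕 (fun ξ => (r ξ : ℂ)) x • Complex.exp (-(t:ℂ) * ‖x‖^2)) volume := by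
    refine hi.mul_bdd (c := 1) hgint.aestronglyMeasurable (.of_forall fun x => ?_)
    rw [hexp, Complex.norm_real, Real.norm_of_nonneg (Real.exp_nonneg _), Real.exp_le_one_iff]
    have : 0 ≤ t * ‖x‖^2 := by positivity
    linarith
  let c : ℝ := (Real.pi / t) ^ ((n:ℝ)/2)
  have hc0 : 0 < c := by positivity
  have hft : ∀ x : En n, 𝓕 (fun v : En n => Complex.exp (-(t:ℂ) * ‖v‖^2)) x = 
      ((c * Real.exp (-Real.pi^2 * ‖x‖^2 / t) : ℝ) : ℂ) := by
    intro x
    rw [fourier_gaussian_innerProductSpace htc]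
    simp only [c, finrank_euclideanSpace_fin]
    push_cast
    rw [Complex.ofReal_cpow (by positivity)]
    push_cast; rfl
  have e1 : ∫ x, (𝓕 (fun ξ => (r ξ : ℂ)) x).re * Real.exp (-(t * ‖x‖^2)) = 
      (∫ x, 𝓕 (fun ξ => (r ξ : ℂ)) x • Complex.exp (-(t:ℂ) * ‖x‖^2)).re := by
    have := Complex.reCLM.integral_comp_comm hint1
    simp only [Complex.reCLM_apply] at this
    rw [← this]
    congr 1; ext x
    rw [hexp, smul_eq_mul, Complex.re_mul_ofReal]
  rw [e1, key]
  have e2 : ∫ x, (r x : ℂ) • 𝓕 (fun v : En n => Complex.exp (-(t:ℂ) * ‖v‖^2)) x = 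
      ((∫ x, r x * (c * Real.exp (-Real.pi^2 * ‖x‖^2 / t)) : ℝ) : ℂ) := by
    rw [← integral_complex_ofReal]
    congr 1; ext x; rw [hft]; simp
  rw [e2, Complex.ofReal_re]
  obtain ⟨ξ, hξ⟩ := hp
  refine Continuous.integral_pos_of_hasCompactSupport_nonneg_nonzero (x := ξ) (by fun_prop) hc.mul_right
    (fun x => mul_nonneg (h0 x) (by positivity)) ?_
  exact (mul_pos hξ (by positivity)).ne'

open FourierTransform

/-- Existence of a positive direction for the fundamental solution of a
uniformly elliptic constant-coefficient operator of order 2m in dimension n > 2m. -/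
theorem stmt0 (n m : ℕ) (hm : 1 ≤ m) (hn : 2*m < n)
    (A : (Fin (2*m) → Fin n) → ℝ) (lam : ℝ) (hlam : 0 < lam)
    (hell : ∀ ξ : En n, lam * ‖ξ‖^(2*m) ≤ symbolQ n m A ξ)
    (K : En n → ℝ)
    (hKloc : LocallyIntegrable K volume)
    (hKcont : ContinuousOn K {(0 : En n)}ᶜ)
    (hKhom : HomogeneousDeg n ((2*m : ℝ) - n) K)
    (hKfund : IsFundamentalSolution n m A K) :
    ∃ y : En n, y ≠ 0 ∧ 0 < K y := by
  have hn0 : 0 < n := by omega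
  have hnR : (2*m : ℝ) < n := by exact_mod_cast hn
  have hmR : (1 : ℝ) ≤ m := by exact_mod_cast hm
  have hQ : ∀ ξ : En n, ξ ≠ 0 → 0 < symbolQ n m A ξ := fun ξ hξ => by
    have : 0 < ‖ξ‖ := norm_pos_iff.2 hξ
    exact lt_of_lt_of_le (by positivity) (hell ξ)
  let g : En n → ℝ := fun ξ => rho n ξ / symbolQ n m A ξ
  have hgs : ContDiff ℝ (⊤ : ℕ∞) g := g_smooth n m A hQ
  have hgc : HasCompactSupport g := by
    have : g = fun ξ => rho n ξ * (symbolQ n m A ξ)⁻¹ := by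
      ext ξ; exact div_eq_mul_inv _ _
    rw [this]
    exact (rho_cpt n).mul_right
  have hg0 : ∀ ξ, 0 ≤ g ξ := fun ξ => by
    refine div_nonneg (rho_nonneg n ξ) ?_
    exact le_trans (by positivity) (hell ξ)
  have hQg : ∀ ξ, symbolQ n m A ξ * g ξ = rho n ξ := fun ξ => by
    by_cases h : ξ = 0
    · subst h
      simp [g, rho_zero n 0 (by simp)]
    · exact mul_div_cancel₀ _ (hQ ξ h).ne'
  have hgcC : HasCompactSupport (fun ξ => (g ξ : ℂ)) :=
    hgc.comp_left (g := fun t : ℝ => (t : ℂ)) (by simp)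
  have hrcC : HasCompactSupport (fun ξ => (rho n ξ : ℂ)) :=
    (rho_cpt n).comp_left (g := fun t : ℝ => (t : ℂ)) (by simp)
  let gS : SchwartzMap (En n) ℂ := hgcC.toSchwartzMap (Complex.ofRealCLM.contDiff.comp hgs)
  let rS : SchwartzMap (En n) ℂ := hrcC.toSchwartzMap (Complex.ofRealCLM.contDiff.comp (rho_smooth n))
  let ψ : SchwartzMap (En n) ℝ := SchwartzMap.postcompCLM Complex.reCLM (𝓕 gS)
  let f : SchwartzMap (En n) ℝ := SchwartzMap.postcompCLM Complex.reCLM (𝓕 rS)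
  have hψ : (ψ : En n → ℝ) = fun x => (𝓕 (fun ξ => (g ξ : ℂ)) x).re := rfl
  have hf : (f : En n → ℝ) = fun x => (𝓕 (fun ξ => (rho n ξ : ℂ)) x).re := rfl
  obtain ⟨ξ₀, hξ₀, hξ₀'⟩ := rho_exists_pos n hn0
  -- value at zero
  have hψ0 : 0 < ψ 0 := by
    have : ψ 0 = ∫ ξ, g ξ := by
      rw [hψ]
      simp only [Real.fourier_eq, inner_zero_right, neg_zero, AddChar.map_zero_eq_one, one_smul]
      rw [integral_complex_ofReal, Complex.ofReal_re]
    rw [this]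
    exact Continuous.integral_pos_of_hasCompactSupport_nonneg_nonzero (x := ξ₀) hgs.continuous hgc hg0
      (div_pos hξ₀ (hQ _ hξ₀')).ne'
  have hKint := K_int n hn0 _ (by linarith) K hKloc hKcont hKhom
  have h1 := extend_schwartz n m hn0 A K hKloc hKint hKfund ψ
  -- radial
  have hrad : ∀ x y : En n, ‖x‖ = ‖y‖ → f x = f y := by
    intro x y hxy
    have hR := Submodule.reflection_sub hxy
    set R := (ℝ ∙ (x - y))ᗮ.reflection
    have h2 := Real.fourier_comp_linearIsometry R (fun ξ => (rho n ξ : ℂ)) x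
    have h3 : (fun ξ => (rho n ξ : ℂ)) ∘ R = (fun ξ => (rho n ξ : ℂ)) := by
      ext ξ; simp [rho]
    rw [h3, hR] at h2
    rw [hf]; simp only [h2]
  let e : En n := EuclideanSpace.single ⟨0, hn0⟩ 1
  let F : ℝ → ℝ := fun r => f (r • e)
  have hF : ∀ x, f x = F ‖x‖ := fun x => hrad _ _ (by simp [e, norm_smul])
  have h2 : ∀ y, opL n m A ψ y = (2 * Real.pi)^(2*m) * F ‖y‖ := by
    intro y
    rw [hψ, opL_fourier n m A g hgs.continuous hgc, ← hF, hf]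
    simp only [hQg]
  simp only [h2] at h1
  have h3 : (2 * Real.pi)^(2*m) * ∫ y, K y * F ‖y‖ = ψ 0 := by
    rw [← h1, ← integral_const_mul]
    congr 1; ext y; ring
  rw [polar_aux n hn0 _ K hKhom F] at h3
  have ha : -(n:ℝ) < 2*m - n := by linarith
  have hJ := polar_aux n hn0 _ _ (norm_rpow_hom n (2*m - n)) F
  -- positivity
  have hpos : 0 < ∫ x : En n, ‖x‖ ^ ((2*m:ℝ) - n) * F ‖x‖ := by
    have hI := K_int n hn0 _ (by linarith) _ (norm_rpow_loc n hn0 _ ha) (norm_rpow_cont n _) (norm_rpow_hom n ((2*m:ℝ) - n))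
    have es : (2*m:ℝ) - n = -(2 * ((n - 2*m)/2)) := by ring
    simp only [← hF]
    have hint : Integrable (fun x : En n => ‖x‖ ^ ((2*m:ℝ) - n) * f x) volume := by
      let C := 2 ^ (n+1) * ((Finset.Iic (n+1, 0)).sup fun m => SchwartzMap.seminorm ℝ m.1 m.2) f
      refine (hI.norm.const_mul C).mono' ?_ (.of_forall fun x => ?_)
      · exact (norm_rpow_loc n hn0 _ ha).aestronglyMeasurable.mul f.continuous.aestronglyMeasurable
      · have := SchwartzMap.one_add_le_sup_seminorm_apply (𝕜 := ℝ) (m := (n+1, 0)) (k := n+1) (n := 0) le_rfl le_rfl f x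
        rw [norm_iteratedFDeriv_zero] at this
        have hp : 0 < 1 + ‖x‖ := by positivity
        have ee : (1 + ‖x‖) ^ ((n:ℝ)+1) = (1 + ‖x‖) ^ (n+1) := by exact_mod_cast Real.rpow_natCast _ (n+1)
        have hb : ‖f x‖ ≤ C * (1 + ‖x‖) ^ (-((n:ℝ)+1)) := by
          rw [Real.rpow_neg hp.le, ← div_eq_mul_inv, le_div_iff₀ (by positivity), mul_comm, ee]
          exact this
        rw [norm_mul, norm_mul, Real.norm_of_nonneg (by positivity : 0 ≤ (1 + ‖x‖) ^ (-((n:ℝ)+1)))]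
        calc _ ≤ ‖‖x‖ ^ ((2*m:ℝ) - n)‖ * (C * (1 + ‖x‖) ^ (-((n:ℝ)+1))) := by gcongr
          _ = _ := by ring
    rw [es] at hint ⊢
    refine riesz_pos n hn0 _ (by linarith) f f.continuous hint fun t ht => ?_
    rw [hf]
    exact fourier_gauss_pos n (rho n) (rho_smooth n).continuous (rho_cpt n) (rho_nonneg n) ⟨ξ₀, hξ₀⟩
      (𝓕 rS).integrable t ht
  rw [hJ] at hpos
  have hS0 : 0 ≤ ∫ w : Metric.sphere (0 : En n) 1, ‖(w : En n)‖ ^ ((2*m:ℝ) - n) ∂(volume : Measure (En n)).toSphere :=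
    integral_nonneg fun w => by positivity
  have hI0 := pos_of_mul_pos_right hpos hS0
  rw [← h3] at hψ0
  have hKS := pos_of_mul_pos_left (pos_of_mul_pos_right hψ0 (by positivity)) hI0.le
  by_contra hcon
  push Not at hcon
  refine absurd hKS (not_lt.2 (integral_nonpos fun w => hcon w ?_))
  exact ne_zero_of_mem_unit_sphere w
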